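/- Let f : ℝ → ℝ be strictly positive and twice continuously differentiable, let μ ∈ ℝ and β > 0. Assume f^β is integrable; that x ↦ (x−μ) f'(x) f(x)^{β−1}, x ↦ h(x) f(x)^β, x ↦ h(x)² f(x)^β, x ↦ h(x) k(x) f(x)^β, x ↦ (x−μ)² ((log f)'(x))² f(x)^β and x ↦ (x−μ)² (log f)''(x) f(x)^β are integrable; and that (x−μ) f(x)^β → 0, (x−μ) h(x) f(x)^β → 0 and (x−μ)² (log f)'(x) f(x)^β → 0 as x → ±∞. Then (1/2)·(1/β²) − Var_β[h(X)] + (1/(4β)) E_β[r(X) − k(X)] = −Var_β[h(X) − (1/2)k(X)]. -/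

import Mathlib

open MeasureTheory Filter

/-- `h = log f`. -/
noncomputable def hlog (f : ℝ → ℝ) : ℝ → ℝ := fun x => Real.log (f x)

/-- `k(x) = (x−μ) h'(x)`. -/
noncomputable def kfun (f : ℝ → ℝ) (μ : ℝ) : ℝ → ℝ := fun x => (x - μ) * deriv (hlog f) x

/-- `r(x) = (x−μ)² h''(x)`. -/
noncomputable def rfun (f : ℝ → ℝ) (μ : ℝ) : ℝ → ℝ :=
  fun x => (x - μ) ^ 2 * deriv (deriv (hlog f)) x

/-- Tempered expectation `E_β[φ] = Z_β⁻¹ ∫ φ(x) f(x)^β dx`. -/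
noncomputable def Eb (f : ℝ → ℝ) (β : ℝ) (φ : ℝ → ℝ) : ℝ :=
  (∫ x, φ x * f x ^ β) / (∫ x, f x ^ β)

/-- Tempered variance `Var_β[φ] = E_β[φ²] − (E_β[φ])²`. -/
noncomputable def Varb (f : ℝ → ℝ) (β : ℝ) (φ : ℝ → ℝ) : ℝ :=
  Eb f β (fun x => φ x ^ 2) - (Eb f β φ) ^ 2

lemma contDiff_hlog {f : ℝ → ℝ} {n : WithTop ℕ∞} (hf_pos : ∀ x, 0 < f x)
    (hf : ContDiff ℝ n f) : ContDiff ℝ n (hlog f) :=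
  hf.log fun x => (hf_pos x).ne'

lemma hasDerivAt_rpow_of_pos {f : ℝ → ℝ} (hf_pos : ∀ x, 0 < f x) (hf : Differentiable ℝ f)
    (β x : ℝ) :
    HasDerivAt (fun y => f y ^ β) (β * deriv (hlog f) x * f x ^ β) x := by
  have hlogd : deriv (hlog f) x = deriv f x / f x :=
    ((hf x).hasDerivAt.log (hf_pos x).ne').deriv
  convert (hf x).hasDerivAt.rpow_const (p := β) (Or.inl (hf_pos x).ne') using 1
  rw [hlogd, Real.rpow_sub_one (hf_pos x).ne']
  ring

lemma kfun_mul_rpow {f : ℝ → ℝ} (hf_pos : ∀ x, 0 < f x) (hf : Differentiable ℝ f)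
    (μ β x : ℝ) : kfun f μ x * f x ^ β = (x - μ) * deriv f x * f x ^ (β - 1) := by
  have hlogd : deriv (hlog f) x = deriv f x / f x :=
    ((hf x).hasDerivAt.log (hf_pos x).ne').deriv
  rw [kfun, hlogd, Real.rpow_sub_one (hf_pos x).ne']
  ring

/-- `(1/2)V(β) − I(β) + (1/(4β))R(β) = −Var_β[h − k/2]`,
the identity showing the limiting log-acceptance ratio is `N(−σ²/2, σ²)`. -/
theorem limiting_mean_is_minus_half_variance
    (f : ℝ → ℝ) (hf_pos : ∀ x, 0 < f x) (hf : ContDiff ℝ 2 f)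
    (μ β : ℝ) (hβ : 0 < β)
    (h1 : Integrable (fun x => f x ^ β))
    (h2 : Integrable (fun x => (x - μ) * deriv f x * f x ^ (β - 1)))
    (h3 : Integrable (fun x => hlog f x * f x ^ β))
    (h4 : Integrable (fun x => (hlog f x) ^ 2 * f x ^ β))
    (h5 : Integrable (fun x => hlog f x * kfun f μ x * f x ^ β))
    (h6 : Integrable (fun x => (x - μ) ^ 2 * (deriv (hlog f) x) ^ 2 * f x ^ β))
    (h7 : Integrable (fun x => (x - μ) ^ 2 * deriv (deriv (hlog f)) x * f x ^ β))
    (htop1 : Tendsto (fun x => (x - μ) * f x ^ β) atTop (nhds 0))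
    (hbot1 : Tendsto (fun x => (x - μ) * f x ^ β) atBot (nhds 0))
    (htop2 : Tendsto (fun x => (x - μ) * hlog f x * f x ^ β) atTop (nhds 0))
    (hbot2 : Tendsto (fun x => (x - μ) * hlog f x * f x ^ β) atBot (nhds 0))
    (htop3 : Tendsto (fun x => (x - μ) ^ 2 * deriv (hlog f) x * f x ^ β) atTop (nhds 0))
    (hbot3 : Tendsto (fun x => (x - μ) ^ 2 * deriv (hlog f) x * f x ^ β) atBot (nhds 0)) :
    (1 / 2) * (1 / β ^ 2) - Varb f β (hlog f)
        + (1 / (4 * β)) * Eb f β (fun x => rfun f μ x - kfun f μ x)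
      = -Varb f β (fun x => hlog f x - (1 / 2) * kfun f μ x) := by
  have hdf : Differentiable ℝ f := hf.differentiable (by norm_num)
  have hh := contDiff_hlog hf_pos hf
  have dh : ∀ x, HasDerivAt (hlog f) (deriv (hlog f) x) x := fun x =>
    (hh.differentiable (by norm_num) x).hasDerivAt
  have ddh : ∀ x, HasDerivAt (deriv (hlog f)) (deriv (deriv (hlog f)) x) x := fun x =>
    (hh.differentiable_deriv_two x).hasDerivAt
  have dw := hasDerivAt_rpow_of_pos hf_pos hdf β
  have ds : ∀ x, HasDerivAt (fun y : ℝ => y - μ) 1 x := fun x => (hasDerivAt_id x).sub_const μ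
  have hk : Integrable (fun x => kfun f μ x * f x ^ β) := by
    simpa only [kfun_mul_rpow hf_pos hdf] using h2
  have hk2 : Integrable (fun x => kfun f μ x ^ 2 * f x ^ β) := by
    simpa only [kfun, mul_pow] using h6
  have hr : Integrable (fun x => rfun f μ x * f x ^ β) := h7
  have hZ : 0 < ∫ x, f x ^ β := by
    refine (integral_pos_iff_support_of_nonneg (fun x => (Real.rpow_pos_of_pos (hf_pos x) β).le)
      h1).2 ?_
    have hsupp : Function.support (fun x => f x ^ β) = Set.univ :=
      Set.eq_univ_of_forall fun x => (Real.rpow_pos_of_pos (hf_pos x) β).ne'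
    simp [hsupp]
  have stein_k : (∫ x, f x ^ β) + β * ∫ x, kfun f μ x * f x ^ β = 0 := by
    rw [← integral_const_mul, ← integral_add' h1 (hk.const_mul β)]
    simpa using integral_of_hasDerivAt_of_tendsto
      (fun x => ((ds x).mul (dw x)).congr_deriv (by simp only [kfun, Pi.add_apply]; ring))
      (h1.add (hk.const_mul β)) hbot1 htop1
  have stein_hk : (∫ x, hlog f x * f x ^ β) + (∫ x, kfun f μ x * f x ^ β)
      + β * ∫ x, hlog f x * kfun f μ x * f x ^ β = 0 := by
    rw [← integral_const_mul, ← integral_add' h3 hk,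
      ← integral_add' (h3.add hk) (h5.const_mul β)]
    simpa using integral_of_hasDerivAt_of_tendsto
      (fun x => (((ds x).mul (dh x)).mul (dw x)).congr_deriv
        (by simp only [kfun, Pi.mul_apply, Pi.add_apply]; ring))
      ((h3.add hk).add (h5.const_mul β)) hbot2 htop2
  have stein_kk : 2 * (∫ x, kfun f μ x * f x ^ β) + (∫ x, rfun f μ x * f x ^ β)
      + β * ∫ x, kfun f μ x ^ 2 * f x ^ β = 0 := by
    rw [← integral_const_mul, ← integral_const_mul, ← integral_add' (hk.const_mul 2) hr,
      ← integral_add' ((hk.const_mul 2).add hr) (hk2.const_mul β)]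
    simpa using integral_of_hasDerivAt_of_tendsto
      (fun x => ((((ds x).pow 2).mul (ddh x)).mul (dw x)).congr_deriv
        (by simp only [kfun, rfun, Pi.mul_apply, Pi.add_apply, Pi.pow_apply]; push_cast; ring))
      (((hk.const_mul 2).add hr).add (hk2.const_mul β)) hbot3 htop3
  have int_rk : ∫ x, (rfun f μ x - kfun f μ x) * f x ^ β
      = (∫ x, rfun f μ x * f x ^ β) - ∫ x, kfun f μ x * f x ^ β := by
    rw [← integral_sub hr hk]
    simp only [sub_mul]
  have int_hk : ∫ x, (hlog f x - 1 / 2 * kfun f μ x) * f x ^ β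
      = (∫ x, hlog f x * f x ^ β) - 1 / 2 * ∫ x, kfun f μ x * f x ^ β := by
    rw [← integral_const_mul, ← integral_sub h3 (hk.const_mul _)]
    congr 1 with x
    ring
  have int_hk_sq : ∫ x, (hlog f x - 1 / 2 * kfun f μ x) ^ 2 * f x ^ β
      = (∫ x, hlog f x ^ 2 * f x ^ β) - (∫ x, hlog f x * kfun f μ x * f x ^ β)
        + 1 / 4 * ∫ x, kfun f μ x ^ 2 * f x ^ β := by
    rw [← integral_const_mul, ← integral_sub' h4 h5,
      ← integral_add' (h4.sub h5) (hk2.const_mul _)]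
    congr 1 with x
    simp only [Pi.add_apply, Pi.sub_apply]
    ring
  simp only [Varb, Eb, int_rk, int_hk, int_hk_sq]
  generalize (∫ x, f x ^ β) = Z at *
  generalize (∫ x, kfun f μ x * f x ^ β) = K at *
  generalize (∫ x, hlog f x * f x ^ β) = H at *
  generalize (∫ x, rfun f μ x * f x ^ β) = R at *
  generalize (∫ x, hlog f x * kfun f μ x * f x ^ β) = HK at *
  generalize (∫ x, kfun f μ x ^ 2 * f x ^ β) = KK at *
  obtain rfl : Z = -(β * K) := by linarith
  obtain rfl : H = -(K + β * HK) := by linarith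
  obtain rfl : R = -(2 * K + β * KK) := by linarith
  have hK : K ≠ 0 := by
    rintro rfl
    simp at hZ
  field_simp
  ring
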